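/- Let U : ℝ^{d_θ} × ℝ^{d_x} → ℝ be differentiable with ‖∇U(θ,x) − ∇U(θ',x')‖ ≤ L_θ‖θ−θ'‖ + L_x‖x−x'‖ for all θ, θ', x, x' (L_θ, L_x > 0), and satisfy ⟨v − v', ∇U(v) − ∇U(v')⟩ ≥ μ‖v − v'‖² for all v, v' with μ > 0. Define κ(θ) := −log ∫_{ℝ^{d_x}} e^{−U(θ,x)} dx. Then κ is differentiable on ℝ^{d_θ} and its gradient is strongly monotone with the same constant: ⟨θ − θ', ∇κ(θ) − ∇κ(θ')⟩ ≥ μ‖θ − θ'‖² for all θ, θ' ∈ ℝ^{d_θ}. -/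

import Mathlib

open MeasureTheory InnerProductSpace
open scoped RealInnerProductSpace

noncomputable section

/-- The joint Euclidean space `ℝ^{d_θ} × ℝ^{d_x}`, equipped with the ℓ²-(Euclidean) norm. -/
abbrev PairSp (dθ dx : ℕ) := WithLp 2 (EuclideanSpace ℝ (Fin dθ) × EuclideanSpace ℝ (Fin dx))

/-- Form the pair `v = (θ, x)` in the joint Euclidean space. -/
def mkPair {dθ dx : ℕ} (θ : EuclideanSpace ℝ (Fin dθ)) (x : EuclideanSpace ℝ (Fin dx)) :
    PairSp dθ dx := (WithLp.equiv 2 _).symm (θ, x)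

/-- The negative log marginal likelihood `κ(θ) = -log ∫ e^{-U(θ,x)} dx`. -/
def negLogMarginal {dθ dx : ℕ} (U : PairSp dθ dx → ℝ) (θ : EuclideanSpace ℝ (Fin dθ)) : ℝ :=
  -Real.log (∫ x : EuclideanSpace ℝ (Fin dx), Real.exp (-U (mkPair θ x)))

open scoped ENNReal

/-- The midpoint form of the Prékopa–Leindler inequality on a measure space that is also a real
vector space. -/
def PrekopaLeindlerMidpoint (E : Type*) [AddCommGroup E] [Module ℝ E] [MeasureSpace E] : Prop :=
  ∀ f g h : E → ℝ≥0∞, Measurable f → Measurable g → Measurable h →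
    (∀ x y, f x * g y ≤ h ((1 / 2 : ℝ) • (x + y)) ^ 2) →
    (∫⁻ x, f x) * (∫⁻ x, g x) ≤ (∫⁻ x, h x) ^ 2

theorem ENNReal.mul_le_sq_of_add_le_two_mul {x y z : ℝ≥0∞} (h : x + y ≤ 2 * z) :
    x * y ≤ z ^ 2 := by
  rcases eq_or_ne z ∞ with rfl | hz
  · simp
  have hxy : x + y ≠ ∞ := ne_top_of_le_ne_top (ENNReal.mul_ne_top (by simp) hz) h
  obtain ⟨hx, hy⟩ := ENNReal.add_ne_top.1 hxy
  lift x to NNReal using hx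
  lift y to NNReal using hy
  lift z to NNReal using hz
  norm_cast at h ⊢
  rw [← NNReal.coe_le_coe] at h ⊢
  push_cast at h ⊢
  nlinarith [sq_nonneg ((x : ℝ) - y), x.2, y.2, z.2]

/-- The Brunn–Minkowski inequality for compact subsets of the line. -/
theorem IsCompact.volume_add_volume_le_of_add_subset {K L D : Set ℝ} (hK : IsCompact K)
    (hL : IsCompact L) (hK₀ : K.Nonempty) (hL₀ : L.Nonempty)
    (hD : ∀ x ∈ K, ∀ y ∈ L, x + y ∈ D) : volume K + volume L ≤ volume D := by
  obtain ⟨k, hk, hkmax⟩ := hK.exists_isGreatest hK₀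
  obtain ⟨l, hl, hlmin⟩ := hL.exists_isLeast hL₀
  have hKm : volume ((fun x => x + l) '' K) = volume K := by
    rw [Set.image_add_right]; exact measure_preimage_add_right _ _ _
  have hLm : volume ((fun y => k + y) '' L) = volume L := by
    rw [Set.image_add_left]; exact measure_preimage_add _ _ _
  have hdisj : AEDisjoint volume ((fun x => x + l) '' K) ((fun y => k + y) '' L) := by
    refine measure_mono_null (t := {k + l}) ?_ (by simp)
    rintro z ⟨⟨x, hx, rfl⟩, ⟨y, hy, hxy⟩⟩
    have h₁ := hkmax hx
    have h₂ := hlmin hy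
    simp only at hxy
    simp only [Set.mem_singleton_iff]
    linarith
  have hmeas : MeasurableSet ((fun y => k + y) '' L) :=
    (hL.image (by fun_prop)).measurableSet
  rw [← hKm, ← hLm, ← measure_union₀ hmeas.nullMeasurableSet hdisj]
  apply measure_mono
  rintro z (⟨x, hx, rfl⟩ | ⟨y, hy, rfl⟩)
  · exact hD x hx l hl
  · exact hD k hk y hy

/-- The Brunn–Minkowski inequality on the line. -/
theorem MeasurableSet.volume_add_volume_le_of_add_subset {A B D : Set ℝ} (hA : MeasurableSet A)
    (hB : MeasurableSet B) (hA₀ : A.Nonempty) (hB₀ : B.Nonempty)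
    (hD : ∀ x ∈ A, ∀ y ∈ B, x + y ∈ D) : volume A + volume B ≤ volume D := by
  obtain ⟨a, ha⟩ := hA₀
  obtain ⟨b, hb⟩ := hB₀
  rw [hA.measure_eq_iSup_isCompact, hB.measure_eq_iSup_isCompact]
  simp only [iSup_and']
  refine ENNReal.biSup_add_biSup_le' (p := fun K => K ⊆ A ∧ IsCompact K)
    (q := fun K => K ⊆ B ∧ IsCompact K) ⟨∅, by simp⟩ ⟨∅, by simp⟩ ?_
  rintro K ⟨hKA, hK⟩ L ⟨hLB, hL⟩
  calc volume K + volume L ≤ volume (insert a K) + volume (insert b L) := by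
        gcongr <;> exact Set.subset_insert _ _
    _ ≤ volume D := by
        refine (hK.insert a).volume_add_volume_le_of_add_subset (hL.insert b) ⟨a, by simp⟩
          ⟨b, by simp⟩ fun x hx y hy => hD x ?_ y ?_
        · exact Set.insert_subset ha hKA hx
        · exact Set.insert_subset hb hLB hy

theorem MeasurableSet.volume_add_volume_le_of_midpoint_mem {A B C : Set ℝ} (hA : MeasurableSet A)
    (hB : MeasurableSet B) (hA₀ : A.Nonempty) (hB₀ : B.Nonempty)
    (hC : ∀ x ∈ A, ∀ y ∈ B, (1 / 2 : ℝ) * (x + y) ∈ C) :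
    volume A + volume B ≤ 2 * volume C := by
  have h := hA.volume_add_volume_le_of_add_subset hB hA₀ hB₀
    (D := (fun z => (1 / 2 : ℝ) * z) ⁻¹' C) hC
  rw [Real.volume_preimage_mul_left (by norm_num)] at h
  simpa using h

theorem lintegral_add_lintegral_le_two_mul_of_midpoint {f g h : ℝ → ℝ} (hf : Measurable f)
    (hg : Measurable g) (hh : Measurable h) (hf₀ : 0 ≤ f) (hg₀ : 0 ≤ g) (hh₀ : 0 ≤ h)
    (hf₁ : ∀ x, f x ≤ 1) (hg₁ : ∀ x, g x ≤ 1)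
    (hfs : ∀ t < 1, ∃ x, t < f x) (hgs : ∀ t < 1, ∃ x, t < g x)
    (hfgh : ∀ x y, f x * g y ≤ h ((1 / 2 : ℝ) * (x + y)) ^ 2) :
    (∫⁻ x, ENNReal.ofReal (f x)) + ∫⁻ x, ENNReal.ofReal (g x) ≤
      2 * ∫⁻ x, ENNReal.ofReal (h x) := by
  have hanti : ∀ u : ℝ → ℝ, Measurable fun t => volume {x | t < u x} := fun u =>
    Antitone.measurable fun s t hst => measure_mono fun x hx => lt_of_le_of_lt hst hx
  rw [lintegral_eq_lintegral_meas_lt _ (ae_of_all _ hf₀) hf.aemeasurable,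
    lintegral_eq_lintegral_meas_lt _ (ae_of_all _ hg₀) hg.aemeasurable,
    lintegral_eq_lintegral_meas_lt _ (ae_of_all _ hh₀) hh.aemeasurable,
    ← lintegral_add_left (hanti f), ← lintegral_const_mul _ (hanti h)]
  refine setLIntegral_mono ((hanti h).const_mul _) fun t ht => ?_
  have ht : 0 < t := ht
  rcases lt_or_ge t 1 with ht₁ | ht₁
  · refine (measurableSet_lt measurable_const hf).volume_add_volume_le_of_midpoint_mem
      (measurableSet_lt measurable_const hg) (hfs t ht₁) (hgs t ht₁) fun x hx y hy => ?_
    refine lt_of_pow_lt_pow_left₀ 2 (hh₀ _) (lt_of_lt_of_le ?_ (hfgh x y))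
    rw [sq]
    exact mul_lt_mul'' hx hy ht.le ht.le
  · have hf' : {x | t < f x} = ∅ := by
      ext x; simpa using (hf₁ x).trans ht₁
    have hg' : {x | t < g x} = ∅ := by
      ext x; simpa using (hg₁ x).trans ht₁
    simp [hf', hg']

theorem lintegral_mul_lintegral_le_sq_of_midpoint_of_bounded {f g h : ℝ → ℝ} (hf : Measurable f)
    (hg : Measurable g) (hh : Measurable h) (hf₀ : 0 ≤ f) (hg₀ : 0 ≤ g) (hh₀ : 0 ≤ h)
    (hfb : BddAbove (Set.range f)) (hgb : BddAbove (Set.range g))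
    (hfgh : ∀ x y, f x * g y ≤ h ((1 / 2 : ℝ) * (x + y)) ^ 2) :
    (∫⁻ x, ENNReal.ofReal (f x)) * ∫⁻ x, ENNReal.ofReal (g x) ≤
      (∫⁻ x, ENNReal.ofReal (h x)) ^ 2 := by
  have hzero : ∀ u : ℝ → ℝ, BddAbove (Set.range u) → (⨆ x, u x) ≤ 0 →
      ∫⁻ x, ENNReal.ofReal (u x) = 0 := by
    intro u hub hu
    have : ∀ x, ENNReal.ofReal (u x) = 0 := fun x =>
      ENNReal.ofReal_of_nonpos ((le_ciSup hub x).trans hu)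
    simp [this]
  set a := ⨆ x, f x
  set b := ⨆ x, g x
  rcases le_or_gt a 0 with ha₀ | ha₀
  · simp [hzero f hfb ha₀]
  rcases le_or_gt b 0 with hb₀ | hb₀
  · simp [hzero g hgb hb₀]
  set c := √(a * b)
  have hc₀ : 0 < c := Real.sqrt_pos.2 (mul_pos ha₀ hb₀)
  have hcsq : c ^ 2 = a * b := Real.sq_sqrt (mul_pos ha₀ hb₀).le
  have hscale : ∀ (u : ℝ → ℝ) (r : ℝ), Measurable u → 0 < r →
      ∫⁻ x, ENNReal.ofReal (u x) =
        ENNReal.ofReal r * ∫⁻ x, ENNReal.ofReal (u x / r) := by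
    intro u r hu hr
    rw [← lintegral_const_mul _ (hu.div_const r).ennreal_ofReal]
    refine lintegral_congr fun x => ?_
    rw [← ENNReal.ofReal_mul hr.le, mul_div_cancel₀ _ hr.ne']
  have hkey := lintegral_add_lintegral_le_two_mul_of_midpoint (f := fun x => f x / a)
    (g := fun x => g x / b) (h := fun x => h x / c) (hf.div_const a) (hg.div_const b)
    (hh.div_const c) (fun x => div_nonneg (hf₀ x) ha₀.le) (fun x => div_nonneg (hg₀ x) hb₀.le)
    (fun x => div_nonneg (hh₀ x) hc₀.le)
    (fun x => (div_le_one ha₀).2 (le_ciSup hfb x)) (fun x => (div_le_one hb₀).2 (le_ciSup hgb x))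
    (fun t ht => by
      obtain ⟨x, hx⟩ := exists_lt_of_lt_ciSup (show t * a < ⨆ x, f x by nlinarith)
      exact ⟨x, (lt_div_iff₀ ha₀).2 hx⟩)
    (fun t ht => by
      obtain ⟨x, hx⟩ := exists_lt_of_lt_ciSup (show t * b < ⨆ x, g x by nlinarith)
      exact ⟨x, (lt_div_iff₀ hb₀).2 hx⟩)
    (fun x y => by
      rw [div_pow, hcsq, div_mul_div_comm]
      exact div_le_div_of_nonneg_right (hfgh x y) (mul_pos ha₀ hb₀).le)
  rw [hscale f a hf ha₀, hscale g b hg hb₀, hscale h c hh hc₀, mul_mul_mul_comm, mul_pow,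
    ← ENNReal.ofReal_mul ha₀.le, ← ENNReal.ofReal_pow hc₀.le, hcsq]
  gcongr
  exact ENNReal.mul_le_sq_of_add_le_two_mul hkey

theorem prekopaLeindlerMidpoint_real : PrekopaLeindlerMidpoint ℝ := by
  intro f g h hf hg hh hfgh
  have hmono : ∀ u : ℝ → ℝ≥0∞, Monotone fun (n : ℕ) x => min (u x) n := by
    intro u m n hmn x
    exact min_le_min le_rfl (by exact_mod_cast hmn)
  have hsup : ∀ u : ℝ → ℝ≥0∞, Measurable u →
      ∫⁻ x, u x = ⨆ n : ℕ, ∫⁻ x, min (u x) n := by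
    intro u hu
    rw [← lintegral_iSup (fun n => hu.min measurable_const) (hmono u)]
    refine lintegral_congr fun x => ?_
    rw [← inf_iSup_eq, ENNReal.iSup_natCast, inf_top_eq]
  have hne : ∀ (u : ℝ → ℝ≥0∞) (n : ℕ) (x : ℝ), min (u x) n ≠ ∞ := fun u n x =>
    ne_top_of_le_ne_top (ENNReal.natCast_ne_top n) (min_le_right _ _)
  have hreal : ∀ (u : ℝ → ℝ≥0∞) (n : ℕ),
      ∫⁻ x, ENNReal.ofReal (min (u x) n).toReal = ∫⁻ x, min (u x) n := fun u n =>
    lintegral_congr fun x => ENNReal.ofReal_toReal (hne u n x)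
  have hbdd : ∀ (u : ℝ → ℝ≥0∞) (n : ℕ), BddAbove (Set.range fun x => (min (u x) n).toReal) := by
    intro u n
    refine ⟨n, ?_⟩
    rintro _ ⟨x, rfl⟩
    simpa using ENNReal.toReal_mono (ENNReal.natCast_ne_top n) (min_le_right (u x) _)
  have htrunc : ∀ n : ℕ, (∫⁻ x, min (f x) n) * ∫⁻ x, min (g x) n ≤ (∫⁻ x, h x) ^ 2 := by
    intro n
    have key := lintegral_mul_lintegral_le_sq_of_midpoint_of_bounded
      (f := fun x => (min (f x) n).toReal) (g := fun x => (min (g x) n).toReal)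
      (h := fun x => (min (h x) n).toReal) (hf.min measurable_const).ennreal_toReal
      (hg.min measurable_const).ennreal_toReal (hh.min measurable_const).ennreal_toReal
      (fun _ => ENNReal.toReal_nonneg) (fun _ => ENNReal.toReal_nonneg)
      (fun _ => ENNReal.toReal_nonneg) (hbdd f n) (hbdd g n) (fun x y => by
        rw [← ENNReal.toReal_mul, ← ENNReal.toReal_pow]
        refine ENNReal.toReal_mono (ENNReal.pow_ne_top (hne h n _)) ?_
        rcases le_total (h ((1 / 2 : ℝ) * (x + y))) n with hn | hn
        · rw [min_eq_left hn]
          exact (mul_le_mul' (min_le_left _ _) (min_le_left _ _)).trans (hfgh x y)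
        · rw [min_eq_right hn, sq]
          exact mul_le_mul' (min_le_right _ _) (min_le_right _ _))
    simp only [hreal] at key
    refine key.trans ?_
    gcongr
    exact min_le_left _ _
  rw [hsup f hf, hsup g hg]
  simp only [ENNReal.iSup_mul, ENNReal.mul_iSup]
  refine iSup_le fun i => iSup_le fun j => (mul_le_mul' ?_ ?_).trans (htrunc (max i j))
  · exact lintegral_mono (hmono f (le_max_right _ _))
  · exact lintegral_mono (hmono g (le_max_left _ _))

theorem PrekopaLeindlerMidpoint.prod {E F : Type*} [AddCommGroup E] [Module ℝ E] [MeasureSpace E]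
    [AddCommGroup F] [Module ℝ F] [MeasureSpace F] [SFinite (volume : Measure F)]
    (hE : PrekopaLeindlerMidpoint E) (hF : PrekopaLeindlerMidpoint F) :
    PrekopaLeindlerMidpoint (E × F) := by
  intro f g h hf hg hh hfgh
  rw [Measure.volume_eq_prod, lintegral_prod _ hf.aemeasurable, lintegral_prod _ hg.aemeasurable,
    lintegral_prod _ hh.aemeasurable]
  refine hE _ _ _ hf.lintegral_prod_right' hg.lintegral_prod_right' hh.lintegral_prod_right'
    fun x x' => ?_
  exact hF _ _ _ (hf.comp measurable_prodMk_left) (hg.comp measurable_prodMk_left)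
    (hh.comp measurable_prodMk_left) fun y y' => hfgh (x, y) (x', y')

theorem PrekopaLeindlerMidpoint.of_measurePreserving {E F : Type*} [AddCommGroup E] [Module ℝ E]
    [MeasureSpace E] [AddCommGroup F] [Module ℝ F] [MeasureSpace F]
    (hE : PrekopaLeindlerMidpoint E) (e : E ≃ᵐ F) (he : MeasurePreserving e)
    (hmid : ∀ x y, e ((1 / 2 : ℝ) • (x + y)) = (1 / 2 : ℝ) • (e x + e y)) :
    PrekopaLeindlerMidpoint F := by
  intro f g h hf hg hh hfgh
  simp only [← he.lintegral_comp_emb e.measurableEmbedding]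
  refine hE _ _ _ (hf.comp e.measurable) (hg.comp e.measurable) (hh.comp e.measurable)
    fun x y => ?_
  rw [hmid]
  exact hfgh _ _

theorem prekopaLeindlerMidpoint_pi (n : ℕ) : PrekopaLeindlerMidpoint (Fin n → ℝ) := by
  induction n with
  | zero =>
    intro f g h _ _ _ hfgh
    rw [Measure.volume_pi_eq_dirac 0]
    have := hfgh 0 0
    simpa using this
  | succ n ih =>
    exact (prekopaLeindlerMidpoint_real.prod ih).of_measurePreserving
      (MeasurableEquiv.piFinSuccAbove (fun _ => ℝ) 0).symm
      (volume_preserving_piFinSuccAbove (fun _ => ℝ) 0).symm (by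
        intro x y
        apply (MeasurableEquiv.piFinSuccAbove (fun _ => ℝ) 0).injective
        rw [MeasurableEquiv.apply_symm_apply]
        ext i
        · simp [MeasurableEquiv.piFinSuccAbove, Fin.insertNthEquiv]
        · simp [MeasurableEquiv.piFinSuccAbove, Fin.insertNthEquiv, Fin.tail])

theorem prekopaLeindlerMidpoint_euclideanSpace (n : ℕ) :
    PrekopaLeindlerMidpoint (EuclideanSpace ℝ (Fin n)) :=
  (prekopaLeindlerMidpoint_pi n).of_measurePreserving (MeasurableEquiv.toLp 2 (Fin n → ℝ))
    (PiLp.volume_preserving_toLp (Fin n)) fun _ _ => rfl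

-- Elaborating `Differentiable.continuous` directly on a `WithLp` product is very slow.
theorem continuous_of_differentiable {E : Type*} [NormedAddCommGroup E] [InnerProductSpace ℝ E]
    {U : E → ℝ} (hU : Differentiable ℝ U) : Continuous U :=
  hU.continuous

section StrongConvexity

variable {E : Type*} [NormedAddCommGroup E] [InnerProductSpace ℝ E] [CompleteSpace E]

/-- A differentiable function with strongly monotone gradient satisfies the first-order
condition for strong convexity. -/
theorem add_inner_gradient_add_le_of_strongly_monotone {U : E → ℝ} {μ : ℝ}
    (hdiff : Differentiable ℝ U)
    (hmono : ∀ v v' : E, μ * ‖v - v'‖ ^ 2 ≤ ⟪v - v', gradient U v - gradient U v'⟫_ℝ) (v d : E) :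
    U v + ⟪gradient U v, d⟫_ℝ + μ / 2 * ‖d‖ ^ 2 ≤ U (v + d) := by
  have hderiv : ∀ t : ℝ, HasDerivAt
      (fun t : ℝ => U (v + t • d) - t * ⟪gradient U v, d⟫_ℝ - μ / 2 * ‖d‖ ^ 2 * t ^ 2)
      (⟪gradient U (v + t • d), d⟫_ℝ - ⟪gradient U v, d⟫_ℝ - μ / 2 * ‖d‖ ^ 2 * (2 * t)) t := by
    intro t
    have hline : HasDerivAt (fun t : ℝ => v + t • d) d t := by
      simpa using ((hasDerivAt_id t).smul_const d).const_add v
    have hU := (hdiff (v + t • d)).hasFDerivAt.comp_hasDerivAt t hline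
    rw [← inner_gradient_left] at hU
    have hlin := (hasDerivAt_id t).mul_const ⟪gradient U v, d⟫_ℝ
    have hsq := (hasDerivAt_pow 2 t).const_mul (μ / 2 * ‖d‖ ^ 2)
    exact ((hU.sub hlin).sub hsq).congr_deriv (by simp)
  have hmonoOn := monotoneOn_of_deriv_nonneg (convex_Ici (0 : ℝ))
    (fun t _ => (hderiv t).continuousAt.continuousWithinAt)
    (fun t _ => (hderiv t).differentiableAt.differentiableWithinAt) (fun t ht => by
      have ht : 0 < t := by simpa using ht
      rw [(hderiv t).deriv]
      have h := hmono (v + t • d) v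
      rw [add_sub_cancel_left, norm_smul, inner_smul_left, inner_sub_right, Real.norm_eq_abs,
        abs_of_pos ht, real_inner_comm, real_inner_comm (gradient U v)] at h
      simp only [conj_trivial] at h
      have h' : t * (μ * t * ‖d‖ ^ 2) ≤
          t * (⟪gradient U (v + t • d), d⟫_ℝ - ⟪gradient U v, d⟫_ℝ) := by
        linarith
      linarith [le_of_mul_le_mul_left h' ht])
  have h := hmonoOn (Set.mem_Ici.2 le_rfl) (Set.mem_Ici.2 zero_le_one) zero_le_one
  simp only [zero_smul, one_smul, add_zero] at h
  linarith

/-- A function with strongly monotone gradient is strongly midpoint convex. -/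
theorem two_mul_apply_midpoint_add_le_of_strongly_monotone {U : E → ℝ} {μ : ℝ}
    (hdiff : Differentiable ℝ U)
    (hmono : ∀ v v' : E, μ * ‖v - v'‖ ^ 2 ≤ ⟪v - v', gradient U v - gradient U v'⟫_ℝ) (v w : E) :
    2 * U ((1 / 2 : ℝ) • (v + w)) + μ / 4 * ‖v - w‖ ^ 2 ≤ U v + U w := by
  have h₁ := add_inner_gradient_add_le_of_strongly_monotone hdiff hmono
    ((1 / 2 : ℝ) • (v + w)) ((1 / 2 : ℝ) • (v - w))
  have h₂ := add_inner_gradient_add_le_of_strongly_monotone hdiff hmono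
    ((1 / 2 : ℝ) • (v + w)) (-((1 / 2 : ℝ) • (v - w)))
  have e₁ : (1 / 2 : ℝ) • (v + w) + (1 / 2 : ℝ) • (v - w) = v := by module
  have e₂ : (1 / 2 : ℝ) • (v + w) + -((1 / 2 : ℝ) • (v - w)) = w := by module
  rw [e₁, norm_smul, mul_pow] at h₁
  rw [e₂, norm_neg, norm_smul, mul_pow, inner_neg_right] at h₂
  norm_num at h₁ h₂
  norm_num
  linarith

/-- A midpoint convex function on the line lies above its tangent at the origin. -/
theorem le_sub_of_midpoint_le_of_hasDerivAt {φ : ℝ → ℝ} {c : ℝ} (hφ : HasDerivAt φ c 0)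
    (hmid : ∀ s, 2 * φ (s / 2) ≤ φ 0 + φ s) : c ≤ φ 1 - φ 0 := by
  have hseq : Filter.Tendsto (fun n : ℕ => ((1 / 2 : ℝ) ^ n)) Filter.atTop (nhdsWithin 0 {0}ᶜ) :=
    tendsto_nhdsWithin_iff.2 ⟨tendsto_pow_atTop_nhds_zero_of_lt_one (by norm_num) (by norm_num),
      Filter.Eventually.of_forall fun n => by simp⟩
  refine le_of_tendsto (hφ.tendsto_slope.comp hseq) (Filter.Eventually.of_forall fun n => ?_)
  simp only [Function.comp_apply, slope_def_field, sub_zero]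
  rw [div_le_iff₀ (by positivity)]
  induction n with
  | zero => simp
  | succ n ih =>
    have h := hmid ((1 / 2) ^ n)
    rw [show (1 / 2 : ℝ) ^ n / 2 = (1 / 2) ^ (n + 1) by rw [pow_succ]; ring] at h
    rw [pow_succ] at h ⊢
    linarith

/-- A differentiable strongly midpoint convex function has strongly monotone gradient. -/
theorem strongly_monotone_gradient_of_midpoint {K : E → ℝ} {μ : ℝ}
    (hdiff : Differentiable ℝ K)
    (hmid : ∀ v w, 2 * K ((1 / 2 : ℝ) • (v + w)) + μ / 4 * ‖v - w‖ ^ 2 ≤ K v + K w) (v w : E) :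
    μ * ‖v - w‖ ^ 2 ≤ ⟪v - w, gradient K v - gradient K w⟫_ℝ := by
  have hfirst : ∀ v d : E, ⟪gradient K v, d⟫_ℝ ≤ K (v + d) - μ / 2 * ‖d‖ ^ 2 - K v := by
    intro v d
    have hline : HasDerivAt (fun t : ℝ => v + t • d) d 0 := by
      simpa using ((hasDerivAt_id (0 : ℝ)).smul_const d).const_add v
    have hK := (hdiff (v + (0 : ℝ) • d)).hasFDerivAt.comp_hasDerivAt 0 hline
    rw [← inner_gradient_left, zero_smul, add_zero] at hK
    have hsq := (hasDerivAt_pow 2 (0 : ℝ)).const_mul (μ / 2 * ‖d‖ ^ 2)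
    have h := le_sub_of_midpoint_le_of_hasDerivAt (hK.sub hsq) fun s => by
      have := hmid v (v + s • d)
      have e : (1 / 2 : ℝ) • (v + (v + s • d)) = v + (s / 2) • d := by module
      rw [e, sub_add_cancel_left, norm_neg, norm_smul, mul_pow, Real.norm_eq_abs, sq_abs] at this
      simp
      linarith
    simpa using h
  have h₁ := hfirst v (w - v)
  have h₂ := hfirst w (v - w)
  rw [add_sub_cancel, ← neg_sub v w, norm_neg, inner_neg_right] at h₁
  rw [add_sub_cancel] at h₂
  rw [inner_sub_right, real_inner_comm, real_inner_comm (gradient K w)]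
  linarith

end StrongConvexity

section Marginal

variable {dθ dx : ℕ}

theorem norm_sq_mkPair (θ : EuclideanSpace ℝ (Fin dθ)) (x : EuclideanSpace ℝ (Fin dx)) :
    ‖mkPair θ x‖ ^ 2 = ‖θ‖ ^ 2 + ‖x‖ ^ 2 :=
  WithLp.prod_norm_sq_eq_of_L2 _

/-- The inclusion of the first factor of the joint space. -/
def mkPairLeft (dθ dx : ℕ) : EuclideanSpace ℝ (Fin dθ) →L[ℝ] PairSp dθ dx :=
  (WithLp.prodContinuousLinearEquiv 2 ℝ (EuclideanSpace ℝ (Fin dθ))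
    (EuclideanSpace ℝ (Fin dx))).symm.toContinuousLinearMap ∘L
    ContinuousLinearMap.inl ℝ _ _

theorem mkPair_eq_mkPairLeft_add (θ : EuclideanSpace ℝ (Fin dθ))
    (x : EuclideanSpace ℝ (Fin dx)) : mkPair θ x = mkPairLeft dθ dx θ + mkPair 0 x := by
  apply (WithLp.equiv 2 _).injective
  simp [mkPair, mkPairLeft]

theorem hasFDerivAt_mkPair_left (θ : EuclideanSpace ℝ (Fin dθ)) (x : EuclideanSpace ℝ (Fin dx)) :
    HasFDerivAt (fun θ => mkPair θ x) (mkPairLeft dθ dx) θ := by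
  have h : (fun θ => mkPair θ x) = fun θ => mkPairLeft dθ dx θ + mkPair 0 x :=
    funext fun θ => mkPair_eq_mkPairLeft_add θ x
  rw [h]
  exact (mkPairLeft dθ dx).hasFDerivAt.add_const _

theorem continuous_mkPair_right (θ : EuclideanSpace ℝ (Fin dθ)) :
    Continuous fun x : EuclideanSpace ℝ (Fin dx) => mkPair θ x :=
  (WithLp.prod_continuous_toLp 2 _ _).comp (by fun_prop)

theorem integrable_exp_neg_mul_norm_sq {b : ℝ} (hb : 0 < b) :
    Integrable fun x : EuclideanSpace ℝ (Fin dx) => Real.exp (-b * ‖x‖ ^ 2) := by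
  have h := (GaussianFourier.integrable_cexp_neg_mul_sq_norm_add (b := (b : ℂ))
    (V := EuclideanSpace ℝ (Fin dx)) (by simpa using hb) 0 0).re
  refine h.congr (ae_of_all _ fun x => ?_)
  simp only [zero_mul, add_zero]
  norm_cast

variable {U : PairSp dθ dx → ℝ} {μ : ℝ}

/-- A differentiable function with strongly monotone gradient grows quadratically. -/
theorem exists_add_norm_sq_le_apply_mkPair (hμ : 0 < μ) (hdiff : Differentiable ℝ U)
    (hmono : ∀ v v' : PairSp dθ dx,
      μ * ‖v - v'‖ ^ 2 ≤ ⟪v - v', gradient U v - gradient U v'⟫_ℝ) :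
    ∃ C, ∀ θ x, C + μ / 4 * ‖x‖ ^ 2 ≤ U (mkPair θ x) := by
  refine ⟨U 0 - ‖gradient U 0‖ ^ 2 / μ, fun θ x => ?_⟩
  have h := add_inner_gradient_add_le_of_strongly_monotone hdiff hmono 0 (mkPair θ x)
  rw [zero_add] at h
  have hin := (abs_le.1 (abs_real_inner_le_norm (gradient U 0) (mkPair θ x))).1
  have hn := norm_sq_mkPair θ x
  set G := ‖gradient U 0‖
  set r := ‖mkPair θ x‖
  have hyoung : G * r ≤ G ^ 2 / μ + μ / 4 * r ^ 2 := by
    have : G ^ 2 / μ + μ / 4 * r ^ 2 - G * r = (G - μ / 2 * r) ^ 2 / μ := by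
      field_simp
      ring
    have h₀ : 0 ≤ (G - μ / 2 * r) ^ 2 / μ := by positivity
    linarith
  have hx : μ / 4 * ‖x‖ ^ 2 ≤ μ / 4 * r ^ 2 := by
    refine mul_le_mul_of_nonneg_left ?_ (by positivity)
    linarith [sq_nonneg ‖θ‖]
  linarith

theorem integrable_exp_neg_apply_mkPair (hμ : 0 < μ) (hdiff : Differentiable ℝ U)
    (hmono : ∀ v v' : PairSp dθ dx,
      μ * ‖v - v'‖ ^ 2 ≤ ⟪v - v', gradient U v - gradient U v'⟫_ℝ)
    (θ : EuclideanSpace ℝ (Fin dθ)) :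
    Integrable fun x : EuclideanSpace ℝ (Fin dx) => Real.exp (-U (mkPair θ x)) := by
  obtain ⟨C, hC⟩ := exists_add_norm_sq_le_apply_mkPair hμ hdiff hmono
  refine ((integrable_exp_neg_mul_norm_sq (b := μ / 4) (by positivity)).const_mul
    (Real.exp (-C))).mono' (by
      have := (continuous_of_differentiable hdiff).comp (continuous_mkPair_right (dx := dx) θ)
      exact (Real.continuous_exp.comp this.neg).aestronglyMeasurable) (ae_of_all _ fun x => ?_)
  rw [Real.norm_eq_abs, Real.abs_exp, ← Real.exp_add, Real.exp_le_exp]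
  linarith [hC θ x]

theorem integral_exp_neg_apply_mkPair_pos (hμ : 0 < μ) (hdiff : Differentiable ℝ U)
    (hmono : ∀ v v' : PairSp dθ dx,
      μ * ‖v - v'‖ ^ 2 ≤ ⟪v - v', gradient U v - gradient U v'⟫_ℝ)
    (θ : EuclideanSpace ℝ (Fin dθ)) :
    0 < ∫ x : EuclideanSpace ℝ (Fin dx), Real.exp (-U (mkPair θ x)) :=
  integral_exp_pos (integrable_exp_neg_apply_mkPair hμ hdiff hmono θ)

theorem differentiable_integral_exp_neg_apply_mkPair {Lθ Lx : ℝ} (hLθ : 0 < Lθ) (hLx : 0 < Lx)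
    (hμ : 0 < μ) (hdiff : Differentiable ℝ U)
    (hlip : ∀ (θ θ' : EuclideanSpace ℝ (Fin dθ)) (x x' : EuclideanSpace ℝ (Fin dx)),
      ‖gradient U (mkPair θ x) - gradient U (mkPair θ' x')‖ ≤ Lθ * ‖θ - θ'‖ + Lx * ‖x - x'‖)
    (hmono : ∀ v v' : PairSp dθ dx,
      μ * ‖v - v'‖ ^ 2 ≤ ⟪v - v', gradient U v - gradient U v'⟫_ℝ) :
    Differentiable ℝ fun θ : EuclideanSpace ℝ (Fin dθ) =>
      ∫ x : EuclideanSpace ℝ (Fin dx), Real.exp (-U (mkPair θ x)) := by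
  intro θ₀
  obtain ⟨C, hC⟩ := exists_add_norm_sq_le_apply_mkPair hμ hdiff hmono
  set J := mkPairLeft dθ dx
  set A := ‖gradient U (mkPair 0 0)‖ + Lθ * (‖θ₀‖ + 1) with hA
  have hA₀ : 0 ≤ A := by positivity
  refine (hasFDerivAt_integral_of_dominated_of_fderiv_le (𝕜 := ℝ) (s := Metric.ball θ₀ 1)
    (F := fun θ (x : EuclideanSpace ℝ (Fin dx)) => Real.exp (-U (mkPair θ x)))
    (F' := fun θ x => Real.exp (-U (mkPair θ x)) • -((fderiv ℝ U (mkPair θ x)) ∘L J))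
    (bound := fun x => Real.exp (-C + 2 / μ) * (A + Lx) * ‖J‖ * Real.exp (-(μ / 8) * ‖x‖ ^ 2))
    (Metric.ball_mem_nhds θ₀ one_pos)
    (Filter.Eventually.of_forall fun θ =>
      (integrable_exp_neg_apply_mkPair hμ hdiff hmono θ).aestronglyMeasurable)
    (integrable_exp_neg_apply_mkPair hμ hdiff hmono θ₀) ?_ (ae_of_all _ fun x θ hθ => ?_)
    ((integrable_exp_neg_mul_norm_sq (by positivity)).const_mul _)
    (ae_of_all _ fun x θ _ => ?_)).differentiableAt
  · have h₁ := (measurable_fderiv ℝ U).comp (continuous_mkPair_right (dx := dx) θ₀).measurable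
    have h₂ : Measurable fun x : EuclideanSpace ℝ (Fin dx) =>
        (fderiv ℝ U (mkPair θ₀ x)) ∘L J :=
      ((ContinuousLinearMap.precomp ℝ J).continuous.measurable).comp h₁
    exact (integrable_exp_neg_apply_mkPair hμ hdiff hmono θ₀).aestronglyMeasurable.smul
      h₂.neg.aestronglyMeasurable
  · have hθ' : ‖θ‖ ≤ ‖θ₀‖ + 1 := by
      have := norm_le_norm_add_norm_sub' θ θ₀
      rw [mem_ball_iff_norm] at hθ
      linarith
    have hgrad : ‖fderiv ℝ U (mkPair θ x)‖ ≤ A + Lx * ‖x‖ := by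
      have h₁ : ‖fderiv ℝ U (mkPair θ x)‖ = ‖gradient U (mkPair θ x)‖ := by
        rw [gradient, LinearIsometryEquiv.norm_map]
      have h₂ := hlip θ 0 x 0
      rw [sub_zero, sub_zero] at h₂
      have h₃ := norm_le_norm_add_norm_sub' (gradient U (mkPair θ x)) (gradient U (mkPair 0 0))
      have h₄ : Lθ * ‖θ‖ ≤ Lθ * (‖θ₀‖ + 1) := by gcongr
      rw [h₁, hA]
      linarith
    have hexp : A + Lx * ‖x‖ ≤ (A + Lx) * Real.exp ‖x‖ := by
      have h₁ := Real.add_one_le_exp ‖x‖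
      have h₂ : A * 1 ≤ A * Real.exp ‖x‖ := by gcongr; exact Real.one_le_exp (norm_nonneg x)
      have h₃ : Lx * ‖x‖ ≤ Lx * Real.exp ‖x‖ := by gcongr; linarith
      linarith
    have hsq : ‖x‖ ≤ 2 / μ + μ / 8 * ‖x‖ ^ 2 := by
      have : 2 / μ + μ / 8 * ‖x‖ ^ 2 - ‖x‖ = (4 - μ * ‖x‖) ^ 2 / (8 * μ) := by
        field_simp
        ring
      have h₀ : 0 ≤ (4 - μ * ‖x‖) ^ 2 / (8 * μ) := by positivity
      linarith
    rw [norm_smul, norm_neg, Real.norm_eq_abs, Real.abs_exp]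
    calc Real.exp (-U (mkPair θ x)) * ‖(fderiv ℝ U (mkPair θ x)) ∘L J‖
        ≤ Real.exp (-U (mkPair θ x)) * (((A + Lx) * Real.exp ‖x‖) * ‖J‖) := by
          gcongr
          refine (ContinuousLinearMap.opNorm_comp_le _ _).trans ?_
          gcongr
          exact hgrad.trans hexp
      _ = Real.exp (-U (mkPair θ x) + ‖x‖) * ((A + Lx) * ‖J‖) := by
          rw [Real.exp_add]; ring
      _ ≤ Real.exp ((-C + 2 / μ) + -(μ / 8) * ‖x‖ ^ 2) * ((A + Lx) * ‖J‖) := by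
          refine mul_le_mul_of_nonneg_right (Real.exp_le_exp.2 ?_) (by positivity)
          linarith [hC θ x]
      _ = _ := by rw [Real.exp_add]; ring
  · exact ((hdiff _).hasFDerivAt.comp θ (hasFDerivAt_mkPair_left θ x)).neg.exp

theorem midpoint_negLogMarginal_add_le (hμ : 0 < μ) (hdiff : Differentiable ℝ U)
    (hmono : ∀ v v' : PairSp dθ dx,
      μ * ‖v - v'‖ ^ 2 ≤ ⟪v - v', gradient U v - gradient U v'⟫_ℝ)
    (θ θ' : EuclideanSpace ℝ (Fin dθ)) :
    2 * negLogMarginal U ((1 / 2 : ℝ) • (θ + θ')) + μ / 4 * ‖θ - θ'‖ ^ 2 ≤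
      negLogMarginal U θ + negLogMarginal U θ' := by
  set m := (1 / 2 : ℝ) • (θ + θ')
  set c := Real.exp (-(μ / 8 * ‖θ - θ'‖ ^ 2)) with hc
  have hint := integrable_exp_neg_apply_mkPair hμ hdiff hmono
  have hpos := integral_exp_neg_apply_mkPair_pos hμ hdiff hmono
  have hmeas : ∀ θ : EuclideanSpace ℝ (Fin dθ), Measurable fun x : EuclideanSpace ℝ (Fin dx) =>
      Real.exp (-U (mkPair θ x)) := fun θ =>
    (Real.continuous_exp.comp
      ((continuous_of_differentiable hdiff).comp (continuous_mkPair_right θ)).neg).measurable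
  have hPL := prekopaLeindlerMidpoint_euclideanSpace dx
    (fun x => ENNReal.ofReal (Real.exp (-U (mkPair θ x))))
    (fun x => ENNReal.ofReal (Real.exp (-U (mkPair θ' x))))
    (fun x => ENNReal.ofReal (Real.exp (-U (mkPair m x)) * c))
    (hmeas θ).ennreal_ofReal (hmeas θ').ennreal_ofReal ((hmeas m).mul_const c).ennreal_ofReal
    (fun x y => by
      rw [← ENNReal.ofReal_mul (by positivity), ← ENNReal.ofReal_pow (by positivity)]
      apply ENNReal.ofReal_le_ofReal
      rw [hc, ← Real.exp_add, ← Real.exp_add, ← Real.exp_nat_mul, Real.exp_le_exp]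
      have h := two_mul_apply_midpoint_add_le_of_strongly_monotone hdiff hmono
        (mkPair θ x) (mkPair θ' y)
      have e₁ : (1 / 2 : ℝ) • (mkPair θ x + mkPair θ' y) =
          mkPair m ((1 / 2 : ℝ) • (x + y)) := rfl
      have e₂ : mkPair θ x - mkPair θ' y = mkPair (θ - θ') (x - y) := rfl
      rw [e₁, e₂, norm_sq_mkPair] at h
      have h₀ : 0 ≤ μ / 4 * ‖x - y‖ ^ 2 := by positivity
      push_cast
      linarith)
  rw [← ofReal_integral_eq_lintegral_ofReal (hint θ) (ae_of_all _ fun _ => (Real.exp_pos _).le),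
    ← ofReal_integral_eq_lintegral_ofReal (hint θ') (ae_of_all _ fun _ => (Real.exp_pos _).le),
    ← ofReal_integral_eq_lintegral_ofReal ((hint m).mul_const c)
      (ae_of_all _ fun _ => by positivity), integral_mul_const,
    ← ENNReal.ofReal_mul (hpos θ).le,
    ← ENNReal.ofReal_pow (mul_nonneg (hpos m).le (Real.exp_pos _).le),
    ENNReal.ofReal_le_ofReal_iff (by positivity)] at hPL
  have hlog := Real.log_le_log (mul_pos (hpos θ) (hpos θ')) hPL
  rw [Real.log_mul (hpos θ).ne' (hpos θ').ne', Real.log_pow,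
    Real.log_mul (hpos m).ne' (Real.exp_pos _).ne', Real.log_exp] at hlog
  push_cast at hlog
  simp only [negLogMarginal]
  linarith

end Marginal

/-- under the Lipschitz-gradient and strong-monotonicity assumptions on `U`,
the negative log marginal likelihood `κ` is differentiable and its gradient is `μ`-strongly
monotone: `⟨θ - θ', ∇κ(θ) - ∇κ(θ')⟩ ≥ μ‖θ - θ'‖²`. -/
theorem negLogMarginal_gradient_strongly_monotone
    {dθ dx : ℕ} (hdθ : 1 ≤ dθ) (hdx : 1 ≤ dx) (Lθ Lx μ : ℝ)
    (hLθ : 0 < Lθ) (hLx : 0 < Lx) (hμ : 0 < μ)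
    (U : PairSp dθ dx → ℝ) (hdiff : Differentiable ℝ U)
    (hlip : ∀ (θ θ' : EuclideanSpace ℝ (Fin dθ)) (x x' : EuclideanSpace ℝ (Fin dx)),
      ‖gradient U (mkPair θ x) - gradient U (mkPair θ' x')‖ ≤ Lθ * ‖θ - θ'‖ + Lx * ‖x - x'‖)
    (hmono : ∀ v v' : PairSp dθ dx,
      μ * ‖v - v'‖ ^ 2 ≤ ⟪v - v', gradient U v - gradient U v'⟫_ℝ) :
    Differentiable ℝ (negLogMarginal U) ∧
    ∀ θ θ' : EuclideanSpace ℝ (Fin dθ),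
      μ * ‖θ - θ'‖ ^ 2 ≤
        ⟪θ - θ', gradient (negLogMarginal U) θ - gradient (negLogMarginal U) θ'⟫_ℝ := by
  have hκ : Differentiable ℝ (negLogMarginal U) := fun θ =>
    ((differentiable_integral_exp_neg_apply_mkPair hLθ hLx hμ hdiff hlip hmono θ).log
      (integral_exp_neg_apply_mkPair_pos hμ hdiff hmono θ).ne').neg
  exact ⟨hκ, strongly_monotone_gradient_of_midpoint hκ
    (midpoint_negLogMarginal_add_le hμ hdiff hmono)⟩
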